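/- arXiv:2510.06560 — 4 statements merged into one kernel-verified Lean document; each statement's English description precedes it below -/
import Mathlib

section
/- Let E, D, C be categories, and let F : E ⥤ D and G : C ⥤ D be functors. Assume that C has binary coproducts and that G admits a left adjoint H. Then the projection functor from the comma category Comma F G to the product category E × C, sending an object (x, y, f : F x ⟶ G y) to the pair (x, y), admits a left adjoint. Moreover, a left adjoint is given on objects by (x, y) ↦ (x, H(F x) ⨿ y, Fx ⟶ G(H(F x) ⨿ y)), where the structure morphism is the unit F x ⟶ G(H(F x)) of the adjunction H ⊣ G followed by G applied to the coproduct inclusion H(F x) ⟶ H(F x) ⨿ y. -/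
open CategoryTheory CategoryTheory.Limits

/-- The value of the left adjoint on objects. -/
noncomputable abbrev commaFreeObj
    {E C D : Type*} [Category E] [Category C] [Category D]
    (F : E ⥤ D) (G : C ⥤ D) [HasBinaryCoproducts C]
    (H : D ⥤ C) (adj : H ⊣ G) (p : E × C) : Comma F G :=
  { left := p.1
    right := H.obj (F.obj p.1) ⨿ p.2
    hom := adj.unit.app (F.obj p.1) ≫ G.map coprod.inl }

/-- The hom-set bijection. -/
noncomputable def commaFreeEquiv
    {E C D : Type*} [Category E] [Category C] [Category D]
    (F : E ⥤ D) (G : C ⥤ D) [HasBinaryCoproducts C]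
    (H : D ⥤ C) (adj : H ⊣ G) (p : E × C) (Y : Comma F G) :
    (commaFreeObj F G H adj p ⟶ Y) ≃
      (p ⟶ ((Comma.fst F G).prod' (Comma.snd F G)).obj Y) where
  toFun f := Prod.mkHom f.left (coprod.inr ≫ f.right)
  invFun g :=
    { left := g.1
      right := coprod.desc ((adj.homEquiv _ _).symm (F.map g.1 ≫ Y.hom)) g.2
      w := by
        dsimp
        rw [Category.assoc, ← G.map_comp, coprod.inl_desc, ← adj.homEquiv_unit,
          Equiv.apply_symm_apply] }
  left_inv f := by
    apply CommaMorphism.ext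
    · rfl
    · dsimp
      apply coprod.hom_ext
      · rw [coprod.inl_desc, Equiv.symm_apply_eq, adj.homEquiv_unit]
        have := f.w
        dsimp at this
        rw [this, Category.assoc, ← G.map_comp]
      · rw [coprod.inr_desc]
  right_inv g := by
    ext
    · rfl
    · dsimp
      rw [coprod.inr_desc]

/-- Let `F : E ⥤ D` and `G : C ⥤ D` be functors, where `C` has binary
coproducts and `G` has a left adjoint `H`. Then the projection functor `Comma F G ⥤ E × C`
admits a left adjoint, which is given on objects by
`(x, y) ↦ (x, H(F x) ⨿ y, F x ⟶ G (H (F x) ⨿ y))`, the structure morphism being the unit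
of the adjunction `H ⊣ G` followed by `G` applied to the coproduct inclusion. -/
theorem comma_proj_hasLeftAdjoint
    {E C D : Type*} [Category E] [Category C] [Category D]
    (F : E ⥤ D) (G : C ⥤ D) [HasBinaryCoproducts C]
    (H : D ⥤ C) (adj : H ⊣ G) :
    ∃ L : E × C ⥤ Comma F G,
      Nonempty (L ⊣ (Comma.fst F G).prod' (Comma.snd F G)) ∧
      ∀ p : E × C,
        L.obj p =
          { left := p.1
            right := H.obj (F.obj p.1) ⨿ p.2
            hom := adj.unit.app (F.obj p.1) ≫ G.map coprod.inl } := by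
  have he : ∀ X Y Y' g h, commaFreeEquiv F G H adj X Y' (h ≫ g) =
      commaFreeEquiv F G H adj X Y h ≫ ((Comma.fst F G).prod' (Comma.snd F G)).map g := by
    intro X Y Y' g h
    ext
    · rfl
    · simp [commaFreeEquiv]
  exact ⟨Adjunction.leftAdjointOfEquiv (commaFreeEquiv F G H adj) he,
    ⟨Adjunction.adjunctionOfEquivLeft _ he⟩, fun p => rfl⟩
end

section
/- In the free algebra 𝔽₂⟨a, b⟩ on two noncommuting generators a and b over the field with two elements, the element a·b + a does not belong to the two-sided ideal generated by the three elements a², a² + b² + a·b + b·a + a + b, and b² + b. -/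
open FreeAlgebra

/-- In the free algebra `𝔽₂⟨a, b⟩` on two noncommuting generators over the
field with two elements, the element `a·b + a` does not belong to the two-sided ideal
generated by the three elements `a²`, `a² + b² + a·b + b·a + a + b`, and `b² + b`. -/
theorem ab_add_a_not_mem_twoSidedIdeal :
    let a : FreeAlgebra (ZMod 2) (Fin 2) := FreeAlgebra.ι (ZMod 2) 0
    let b : FreeAlgebra (ZMod 2) (Fin 2) := FreeAlgebra.ι (ZMod 2) 1
    a * b + a ∉
      TwoSidedIdeal.span {a ^ 2, a ^ 2 + b ^ 2 + a * b + b * a + a + b, b ^ 2 + b} := by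
  intro a b h
  let A : Matrix (Fin 2) (Fin 2) (ZMod 2) := !![0, 0; 1, 0]
  let B : Matrix (Fin 2) (Fin 2) (ZMod 2) := !![0, 0; 0, 1]
  let f := FreeAlgebra.lift (ZMod 2) (![A, B] : Fin 2 → Matrix (Fin 2) (Fin 2) (ZMod 2))
  have ha : f a = A := by simp [f, a]
  have hb : f b = B := by simp [f, b]
  have hle : TwoSidedIdeal.span {a ^ 2, a ^ 2 + b ^ 2 + a * b + b * a + a + b, b ^ 2 + b}
      ≤ TwoSidedIdeal.ker f := by
    rw [TwoSidedIdeal.span_le]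
    rintro x (rfl | rfl | rfl)
    all_goals
      rw [SetLike.mem_coe, TwoSidedIdeal.mem_ker]
      simp only [map_add, map_mul, map_pow, ha, hb]
      decide
  have h2 := hle h
  rw [TwoSidedIdeal.mem_ker] at h2
  simp only [map_add, map_mul, ha, hb] at h2
  revert h2
  decide
end

section
/- Let p : C ⥤ E and q : D ⥤ E be Grothendieck fibrations (fibered categories) and let G : C ⥤ D be a functor with q ∘ G = p. Assume that G sends p-cartesian morphisms of C to q-cartesian morphisms of D, and that for every object z of E the induced functor G_z between the fiber category of p over z and the fiber category of q over z admits a left adjoint. Then G admits a left adjoint H such that for every object y of D the unit morphism y ⟶ G(H y) is sent by q to an isomorphism in E. -/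
open CategoryTheory CategoryTheory.Functor

/-- Given `G : C ⥤ D` commuting with `p : C ⥤ E` and `q : D ⥤ E` (i.e. `G ⋙ q = p`), the
induced functor between the fiber of `p` over `z` and the fiber of `q` over `z`. -/
def fiberMap {C D E : Type*} [Category C] [Category D] [Category E]
    (p : C ⥤ E) (q : D ⥤ E) (G : C ⥤ D) (h : G ⋙ q = p) (z : E) :
    p.Fiber z ⥤ q.Fiber z :=
  Fiber.inducedFunctor (p := q) (S := z) (F := Fiber.fiberInclusion ⋙ G)
    (by rw [Functor.assoc, h, Fiber.fiberInclusion_comp_eq_const])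

section RelAdjAux

variable {C D E : Type*} [Category C] [Category D] [Category E]

lemma relAdj_lift_map (q : D ⥤ E) (G : C ⥤ D) {R S : E} (f : R ⟶ S) {a b : C} (φ : a ⟶ b)
    (hφ : (G ⋙ q).IsHomLift f φ) : q.IsHomLift f (G.map φ) := by
  obtain ⟨⟩ := hφ
  exact IsHomLift.map q (G.map φ)

lemma relAdj_lift_of_map (q : D ⥤ E) (G : C ⥤ D) {R S : E} (f : R ⟶ S) {a b : C} (φ : a ⟶ b)
    (hφ : q.IsHomLift f (G.map φ)) : (G ⋙ q).IsHomLift f φ :=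
  IsHomLift.of_fac _ _ _ (IsHomLift.domain_eq q f (G.map φ)) (IsHomLift.codomain_eq q f (G.map φ))
    (IsHomLift.fac q f (G.map φ))

lemma relAdj_cart_map (q : D ⥤ E) (G : C ⥤ D)
    (hcart : ∀ {a b : C} (φ : a ⟶ b),
      (G ⋙ q).IsCartesian ((G ⋙ q).map φ) φ → q.IsCartesian (q.map (G.map φ)) (G.map φ))
    {R S : E} (f : R ⟶ S) {a b : C} (φ : a ⟶ b) (hφ : (G ⋙ q).IsCartesian f φ) :
    q.IsCartesian f (G.map φ) := by
  obtain ⟨⟩ := hφ.toIsHomLift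
  exact hcart φ hφ

lemma relAdj_cancel (q : D ⥤ E) {z S : E} {a b c : D} (η : a ⟶ b) (g : b ⟶ c) (u : z ⟶ S)
    (hη : q.IsHomLift (𝟙 z) η) (hu : q.IsHomLift u (η ≫ g)) : q.IsHomLift u g := by
  have hb := IsHomLift.codomain_eq q (𝟙 z) η
  have hc := IsHomLift.codomain_eq q u (η ≫ g)
  subst hb hc
  have h1 := IsHomLift.fac q u (η ≫ g)
  have h2 := IsHomLift.fac' q (𝟙 (q.obj b)) η
  have : u = q.map g := by rw [h1, q.map_comp, h2]; simp
  rw [this]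
  infer_instance

lemma relAdj_universal (q : D ⥤ E) (G : C ⥤ D) [(G ⋙ q).IsFibered] [q.IsFibered]
    (hcart : ∀ {a b : C} (φ : a ⟶ b),
      (G ⋙ q).IsCartesian ((G ⋙ q).map φ) φ → q.IsCartesian (q.map (G.map φ)) (G.map φ))
    (hfiber : ∀ z : E, (fiberMap (G ⋙ q) q G rfl z).IsRightAdjoint) (y : D) :
    ∃ (x : C) (η : y ⟶ G.obj x), q.IsHomLift (𝟙 (q.obj y)) η ∧
      ∀ (c : C) (f : y ⟶ G.obj c), ∃! g : x ⟶ c, η ≫ G.map g = f := by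
  obtain ⟨L, ⟨adj⟩⟩ := (hfiber (q.obj y)).exists_leftAdjoint
  let Y : q.Fiber (q.obj y) := ⟨y, rfl⟩
  let η : y ⟶ G.obj (L.obj Y).1 := (adj.unit.app Y).1
  have hη : q.IsHomLift (𝟙 (q.obj y)) η := (adj.unit.app Y).2
  refine ⟨(L.obj Y).1, η, hη, fun c f => ?_⟩
  obtain ⟨b, φ, hφ⟩ := IsPreFibered.exists_isCartesian (G ⋙ q) (a := c) rfl (q.map f)
  have hGφ := relAdj_cart_map q G hcart _ φ hφ
  have hb : (G ⋙ q).obj b = q.obj y := IsHomLift.domain_eq (G ⋙ q) (q.map f) φ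
  let B : (G ⋙ q).Fiber (q.obj y) := ⟨b, hb⟩
  let χ : y ⟶ G.obj b := IsCartesian.map q (q.map f) (G.map φ) f
  have hχ : q.IsHomLift (𝟙 (q.obj y)) χ := IsCartesian.map_isHomLift q (q.map f) (G.map φ) f
  have hχf : χ ≫ G.map φ = f := IsCartesian.fac q (q.map f) (G.map φ) f
  let χ' : Y ⟶ (fiberMap (G ⋙ q) q G rfl (q.obj y)).obj B := ⟨χ, hχ⟩
  let ψ := (adj.homEquiv Y B).symm χ'
  have hψ : η ≫ G.map ψ.1 = χ := by
    have := (adj.homEquiv Y B).apply_symm_apply χ'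
    rw [Adjunction.homEquiv_unit] at this
    exact congrArg Subtype.val this
  refine ⟨ψ.1 ≫ φ, ?_, ?_⟩
  · change η ≫ G.map (ψ.1 ≫ φ) = f
    rw [G.map_comp, ← Category.assoc, hψ, hχf]
  · intro g hg
    have hg' : (G ⋙ q).IsHomLift (q.map f) g := by
      apply relAdj_lift_of_map
      apply relAdj_cancel q η (G.map g) _ hη
      rw [hg]; infer_instance
    let τ := IsCartesian.map (G ⋙ q) (q.map f) φ g
    have hτ : (G ⋙ q).IsHomLift (𝟙 (q.obj y)) τ :=
      IsCartesian.map_isHomLift (G ⋙ q) (q.map f) φ g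
    have hτg : τ ≫ φ = g := IsCartesian.fac (G ⋙ q) (q.map f) φ g
    have hGτ := relAdj_lift_map q G _ τ hτ
    have h1 : η ≫ G.map τ = χ := by
      apply IsCartesian.map_uniq q (q.map f) (G.map φ) f
      rw [Category.assoc, ← G.map_comp, hτg, hg]
    let τ' : L.obj Y ⟶ B := ⟨τ, hτ⟩
    have h2 : τ' = ψ := by
      apply (adj.homEquiv Y B).injective
      rw [Adjunction.homEquiv_unit, Adjunction.homEquiv_unit]
      apply Subtype.ext
      exact h1.trans hψ.symm
    rw [← hτg, ← h2]

end RelAdjAux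

/-- Let `p : C ⥤ E` and `q : D ⥤ E` be fibered categories and `G : C ⥤ D`
a functor with `q ∘ G = p` which sends `p`-cartesian morphisms to `q`-cartesian morphisms and
such that the induced functor on each fiber admits a left adjoint. Then `G` admits a left
adjoint `H` relative to `E`: the unit `y ⟶ G (H y)` is sent by `q` to an isomorphism. -/
theorem relative_left_adjoint_of_fibered
    {C D E : Type*} [Category C] [Category D] [Category E]
    (p : C ⥤ E) (q : D ⥤ E) [p.IsFibered] [q.IsFibered]
    (G : C ⥤ D) (h : G ⋙ q = p)
    (hcart : ∀ {a b : C} (φ : a ⟶ b),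
      p.IsCartesian (p.map φ) φ → q.IsCartesian (q.map (G.map φ)) (G.map φ))
    (hfiber : ∀ z : E, (fiberMap p q G h z).IsRightAdjoint) :
    ∃ (H : D ⥤ C) (adj : H ⊣ G), ∀ y : D, IsIso (q.map (adj.unit.app y)) := by
  subst h
  choose x η hη hu using relAdj_universal q G hcart hfiber
  let e : ∀ (Y : D) (c : C), (x Y ⟶ c) ≃ (Y ⟶ G.obj c) := fun Y c =>
    Equiv.ofBijective (fun g => η Y ≫ G.map g)
      ((Function.bijective_iff_existsUnique _).2 (hu Y c))
  have he : ∀ X Y Y' g h, e X Y' (h ≫ g) = e X Y h ≫ G.map g := by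
    intro X Y Y' g h
    simp [e]
  refine ⟨Adjunction.leftAdjointOfEquiv e he, Adjunction.adjunctionOfEquivLeft e he, fun y => ?_⟩
  have h1 : (Adjunction.adjunctionOfEquivLeft e he).unit.app y = η y := by
    simp [Adjunction.adjunctionOfEquivLeft, e]
  rw [h1]
  have := hη y
  rw [IsHomLift.fac' q (𝟙 (q.obj y)) (η y)]
  infer_instance
end

section
/- Let A, B, A', B' be categories. Suppose given: a functor G : A ⥤ B with a left adjoint L : B ⥤ A; functors i_A : A' ⥤ A and i_B : B' ⥤ B admitting left adjoints π_A : A ⥤ A' and π_B : B ⥤ B' respectively; a natural isomorphism π_B ∘ i_B ≅ 𝟭_{B'}; and a functor G' : A' ⥤ B' together with a natural isomorphism G ∘ i_A ≅ i_B ∘ G'. Then the composite functor π_A ∘ L ∘ i_B : B' ⥤ A' is left adjoint to G'. -/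
open CategoryTheory

/-- Let `A, B, A', B'` be categories; let `G : A ⥤ B` have a left adjoint
`L : B ⥤ A`; let `iA : A' ⥤ A` and `iB : B' ⥤ B` have left adjoints `πA : A ⥤ A'` and
`πB : B ⥤ B'`; suppose `πB ∘ iB ≅ 𝟭 B'` and `G ∘ iA ≅ iB ∘ G'` for a functor
`G' : A' ⥤ B'`. Then `πA ∘ L ∘ iB : B' ⥤ A'` is left adjoint to `G'`. -/
theorem heart_left_adjoint
    {A B A' B' : Type*} [Category A] [Category B] [Category A'] [Category B']
    (G : A ⥤ B) (L : B ⥤ A) (_adjL : L ⊣ G)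
    (iA : A' ⥤ A) (πA : A ⥤ A') (_adjA : πA ⊣ iA)
    (iB : B' ⥤ B) (πB : B ⥤ B') (_adjB : πB ⊣ iB)
    (_e : iB ⋙ πB ≅ 𝟭 B')
    (G' : A' ⥤ B') (_w : iA ⋙ G ≅ G' ⋙ iB) :
    Nonempty ((iB ⋙ L ⋙ πA) ⊣ G') := by
  let adj := _adjL.comp _adjA
  exact ⟨Adjunction.mkOfHomEquiv
    { homEquiv := fun X Y =>
        (adj.homEquiv (iB.obj X) Y).trans <|
          (Iso.homCongr (Iso.refl (iB.obj X)) (_w.app Y)).trans <|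
          (_adjB.homEquiv (iB.obj X) (G'.obj Y)).symm.trans <|
          Iso.homCongr (_e.app X) (Iso.refl (G'.obj Y))
      homEquiv_naturality_left_symm := by
        intro X X' Y f g
        have h : _e.hom.app X ≫ f = πB.map (iB.map f) ≫ _e.hom.app X' := by
          simpa using (_e.hom.naturality f).symm
        simp [Adjunction.homEquiv_unit, Adjunction.homEquiv_counit, reassoc_of% h]
      homEquiv_naturality_right := by
        intro X Y Y' f g
        have h : G.map (iA.map g) ≫ _w.hom.app Y' = _w.hom.app Y ≫ iB.map (G'.map g) := by
          simpa using _w.hom.naturality g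
        simp [adj, Adjunction.homEquiv_unit, Adjunction.homEquiv_counit, h] }⟩
end
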